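/- The flows defined by the generating Lax equation commute, as a consequence of the classical Yang–Baxter equation. Precisely: let r be either the rational or the trigonometric r-matrix, and let Q = (Q^a(λ_a))_{a∈ℂP¹} be any gl_N-valued adelic element. For a formal variable κ define the first variation (X_κ Q)(λ) := [ Tr₂( ι_λ ι_κ r₁₂(λ,κ) Q₂(κ) ), Q₁(λ) ] — componentwise, for a, c ∈ ℂP¹, a formal series in λ_a and κ_c with coefficients in gl_N(ℂ) — and define the second variation by the Leibniz rule, X_ν X_μ Q(λ) := [ Tr₂( ι_λ ι_μ r₁₂(λ,μ) (X_ν Q)₂(μ) ), Q₁(λ) ] + [ Tr₂( ι_λ ι_μ r₁₂(λ,μ) Q₂(μ) ), (X_ν Q)₁(λ) ]. Then X_ν X_μ Q(λ) = X_μ X_ν Q(λ), componentwise as formal series in λ_a, μ_b, ν_c for all a, b, c ∈ ℂP¹. -/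

import Mathlib

/-!
# Commutativity of the flows of the generating Lax equation

For `r` the rational or the trigonometric r-matrix and `Q` a `gl_N`-valued adelic
element, define the first variation
`(X_κ Q)(λ) := [ Tr₂( ι_λ ι_κ r₁₂(λ,κ) Q₂(κ) ), Q₁(λ) ]`
(componentwise for `a, c ∈ ℂP¹`, a formal series in `λ_a` and `κ_c`), and the second
variation by the Leibniz rule
`X_ν X_μ Q(λ) := [ Tr₂( ι_λ ι_μ r₁₂(λ,μ) (X_ν Q)₂(μ) ), Q₁(λ) ]
               + [ Tr₂( ι_λ ι_μ r₁₂(λ,μ) Q₂(μ) ), (X_ν Q)₁(λ) ]`.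
Then `X_ν X_μ Q(λ) = X_μ X_ν Q(λ)`, componentwise as triple formal series in
`λ_a, μ_b, ν_c` for all `a, b, c ∈ ℂP¹` (a consequence of the CYBE).

Using `Tr₂(P₁₂M₂) = M`, `Tr₂(P⁻₁₂M₂) = P⁻M`, `Tr₂(P⁰₁₂M₂) = P⁰M`, the quantity
`Tr₂(ι_λ ι_κ r₁₂(λ,κ) M₂(κ))` is the double expansion of the scalar kernel (`1/(κ−λ)`,
resp. `κ/(κ−λ)`) Cauchy-multiplied with the `κ`-series `M`, minus (trigonometric case)
the `λ`-constant part `(P⁻+½P⁰)M(κ)`.  `ι_λ ι_κ` expands first in `κ` (about each point),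
then in `λ`.  Exchanging `μ ↔ ν` exchanges the pairs `(b,m) ↔ (c,s)`.
-/

set_option synthInstance.maxHeartbeats 400000
noncomputable section
open Polynomial

abbrev Rf : Type := RatFunc ℂ
abbrev Rf2 : Type := RatFunc Rf
/-- `ℂP¹ = ℂ ∪ {∞}`; `none` is the point at infinity -/
abbrev CP1 : Type := Option ℂ
abbrev glC (N : ℕ) : Type := Matrix (Fin N) (Fin N) ℂ
abbrev AdeleData (N : ℕ) : Type := CP1 → ℤ → glC N

def laurentCoeffAt {F : Type*} [Field F] (b : F) (f : RatFunc F) (n : ℤ) : F :=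
  ((RatFunc.laurent b f : LaurentSeries F)).coeff n

def invSubst {F : Type*} [Field F] (f : RatFunc F) : RatFunc F :=
  (algebraMap F[X] (RatFunc F) f.num.reverse * RatFunc.X ^ f.denom.natDegree) /
    (algebraMap F[X] (RatFunc F) f.denom.reverse * RatFunc.X ^ f.num.natDegree)

def expC {F : Type*} [Field F] (a : Option F) (f : RatFunc F) (n : ℤ) : F :=
  match a with
  | some b => laurentCoeffAt b f n
  | none => ((invSubst f : LaurentSeries F)).coeff n

def pt (b : CP1) : Option Rf := b.map (algebraMap ℂ Rf)

/-- `1/(κ−λ)`, outer variable `κ` -/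
def cMuOuter : Rf2 := (RatFunc.X - RatFunc.C (RatFunc.X : Rf))⁻¹
/-- `κ/(κ−λ)`, outer variable `κ` -/
def sMuOuter : Rf2 := RatFunc.X * (RatFunc.X - RatFunc.C (RatFunc.X : Rf))⁻¹

/-- `ι_{λ_a}ι_{κ_c} s`: coefficient of `λ_a^t κ_c^m` (expand first in `κ_c`, then `λ_a`) -/
def dMuFirst (s : Rf2) (a c : CP1) (t m : ℤ) : ℂ := expC a (expC (pt c) s m) t

def lowP {N : ℕ} (M : glC N) : glC N := Matrix.of fun i j => if j < i then M i j else 0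
def diagP {N : ℕ} (M : glC N) : glC N := Matrix.of fun i j => if i = j then M i j else 0

def LaurentBdd {N : ℕ} (X : AdeleData N) : Prop := ∀ a, ∃ M : ℤ, ∀ n, n < M → X a n = 0
def AlmostTaylor {N : ℕ} (X : AdeleData N) : Prop := {a : CP1 | ∃ n, n < 0 ∧ X a n ≠ 0}.Finite
def IsAdele {N : ℕ} (X : AdeleData N) : Prop := LaurentBdd X ∧ AlmostTaylor X

/-- `Tr₂( ι_{λ_a} ι_{κ_c} r₁₂(λ,κ) M₂(κ_c) )` for the scalar double expansion `d`;
`cpart = true` adds the trigonometric constant part `−(P⁻+½P⁰)M(κ_c)`.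
Coefficient of `λ_a^t κ_c^m`. -/
def TrIotaM {N : ℕ} (d : CP1 → CP1 → ℤ → ℤ → ℂ) (cpart : Bool)
    (a c : CP1) (M : ℤ → glC N) (t m : ℤ) : glC N :=
  (∑ᶠ p : ℤ, d a c t p • M (m - p))
    - (if cpart = true ∧ t = 0 then lowP (M m) + (2:ℂ)⁻¹ • diagP (M m) else 0)

/-- first variation `(X_κ Q)^{a,c}(λ_a,κ_c)`, coefficient of `λ_a^t κ_c^s` -/
def firstVar {N : ℕ} (d : CP1 → CP1 → ℤ → ℤ → ℂ) (cpart : Bool)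
    (Q : AdeleData N) (a c : CP1) (t s : ℤ) : glC N :=
  ∑ᶠ u : ℤ, (TrIotaM d cpart a c (Q c) u s * Q a (t - u)
    - Q a (t - u) * TrIotaM d cpart a c (Q c) u s)

/-- second variation `(X_ν X_μ Q)^{a,b,c}(λ_a,μ_b,ν_c)` by the Leibniz rule, coefficient
of `λ_a^t μ_b^m ν_c^s` -/
def secondVar {N : ℕ} (d : CP1 → CP1 → ℤ → ℤ → ℂ) (cpart : Bool)
    (Q : AdeleData N) (a b c : CP1) (t m s : ℤ) : glC N :=
  (∑ᶠ u : ℤ,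
    (TrIotaM d cpart a b (fun m' => firstVar d cpart Q b c m' s) u m * Q a (t - u)
      - Q a (t - u) * TrIotaM d cpart a b (fun m' => firstVar d cpart Q b c m' s) u m))
  + (∑ᶠ u : ℤ,
    (TrIotaM d cpart a b (Q b) u m * firstVar d cpart Q a c (t - u) s
      - firstVar d cpart Q a c (t - u) s * TrIotaM d cpart a b (Q b) u m))

/-- coefficientwise multiplication by `κ = κ_b + b` (or `κ = κ_∞⁻¹`) in the local coordinate at `b` -/
def mulCoord {F W : Type*} [SMul F W] [Add W] (b : Option F) (h : ℤ → W) (n : ℤ) : W :=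
  match b with
  | some β => h (n - 1) + β • h n
  | none => h (n + 1)

section Expansion
variable {F : Type*} [Field F]

/-- the substitution `X ↦ X⁻¹` on rational functions -/
def invHom (F : Type*) [Field F] : RatFunc F →+* RatFunc F :=
  RatFunc.liftRingHom (Polynomial.aeval (R := F) (RatFunc.X : RatFunc F)⁻¹).toRingHom (by
    intro p hp
    have h : Function.Injective (Polynomial.aeval (R := F) (RatFunc.X : RatFunc F)⁻¹) := by
      rw [← transcendental_iff_injective]
      intro ha
      have := ha.inv
      rw [inv_inv] at this
      exact RatFunc.transcendental_X this
    simp only [Submonoid.mem_comap, mem_nonZeroDivisors_iff_ne_zero] at hp ⊢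
    exact (map_ne_zero_iff _ h).2 hp)

lemma aeval_inv_X (p : F[X]) :
    Polynomial.aeval (RatFunc.X : RatFunc F)⁻¹ p
      = algebraMap F[X] (RatFunc F) p.reverse / RatFunc.X ^ p.natDegree := by
  have hX : (RatFunc.X : RatFunc F) ≠ 0 := RatFunc.X_ne_zero
  let _ : Invertible (RatFunc.X : RatFunc F)⁻¹ :=
    ⟨RatFunc.X, mul_inv_cancel₀ hX, inv_mul_cancel₀ hX⟩
  have h := Polynomial.eval₂_reverse_mul_pow (algebraMap F (RatFunc F)) (RatFunc.X : RatFunc F)⁻¹ p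
  rw [Polynomial.aeval_def, ← h]
  have h2 : (⅟(RatFunc.X : RatFunc F)⁻¹) = RatFunc.X := rfl
  rw [h2, ← Polynomial.aeval_def, RatFunc.aeval_X_left_eq_algebraMap, inv_pow, div_eq_mul_inv]

lemma invSubst_eq (f : RatFunc F) : invSubst f = invHom F f := by
  conv_rhs => rw [← RatFunc.num_div_denom f]
  rw [invHom, RatFunc.liftRingHom_apply_div]
  have hX : (RatFunc.X : RatFunc F) ≠ 0 := RatFunc.X_ne_zero
  simp only [AlgHom.toRingHom_eq_coe, RingHom.coe_coe]
  rw [aeval_inv_X, aeval_inv_X, invSubst]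
  field_simp

lemma invHom_X : invHom F RatFunc.X = RatFunc.X⁻¹ := by
  rw [invHom, RatFunc.liftRingHom_X]
  simp

lemma invHom_C (c : F) : invHom F (RatFunc.C c) = RatFunc.C c := by
  rw [invHom, RatFunc.liftRingHom_C]
  simp

/-- the embedding of rational functions into Laurent series at the origin -/
def coeHom (F : Type*) [Field F] : RatFunc F →+* LaurentSeries F :=
  open scoped RatFunc in algebraMap (RatFunc F) (LaurentSeries F)

lemma coeHom_X : coeHom F RatFunc.X = HahnSeries.single 1 1 := RatFunc.coe_X

lemma coeHom_C (c : F) : coeHom F (RatFunc.C c) = HahnSeries.C c := by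
  rw [← RatFunc.algebraMap_C]
  refine (RatFunc.coe_coe (Polynomial.C c)).symm.trans ?_
  simp

/-- the expansion at a point as a ring homomorphism -/
def expHom (a : Option F) : RatFunc F →+* LaurentSeries F :=
  match a with
  | some b => (coeHom F).comp (RatFunc.laurent b).toRingHom
  | none => (coeHom F).comp (invHom F)

lemma expC_eq (a : Option F) (f : RatFunc F) (n : ℤ) : expC a f n = (expHom a f).coeff n := by
  cases a with
  | some b => rfl
  | none => simp only [expC, invSubst_eq]; rfl

lemma expHom_C (a : Option F) (c : F) : expHom a (RatFunc.C c) = HahnSeries.C c := by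
  cases a with
  | some b =>
    change coeHom F (RatFunc.laurent b (RatFunc.C c)) = _
    rw [RatFunc.laurent_C, coeHom_C]
  | none =>
    change coeHom F (invHom F (RatFunc.C c)) = _
    rw [invHom_C, coeHom_C]

lemma expHom_X (a : Option F) :
    expHom a RatFunc.X
      = a.elim (HahnSeries.single (-1) 1) (fun b => HahnSeries.single 1 1 + HahnSeries.C b) := by
  cases a with
  | some b =>
    change coeHom F (RatFunc.laurent b RatFunc.X) = _
    rw [RatFunc.laurent_X, map_add, coeHom_X, coeHom_C]
    rfl
  | none =>
    change coeHom F (invHom F RatFunc.X) = _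
    rw [invHom_X, map_inv₀, coeHom_X, HahnSeries.inv_single]
    simp

lemma expC_add (a : Option F) (f g : RatFunc F) (n : ℤ) :
    expC a (f + g) n = expC a f n + expC a g n := by
  simp [expC_eq]

lemma expC_sub (a : Option F) (f g : RatFunc F) (n : ℤ) :
    expC a (f - g) n = expC a f n - expC a g n := by
  simp [expC_eq]

lemma expC_zero (a : Option F) (n : ℤ) : expC a 0 n = 0 := by
  simp [expC_eq]

lemma expC_one (a : Option F) (n : ℤ) : expC a 1 n = if n = 0 then 1 else 0 := by
  simp [expC_eq, HahnSeries.coeff_one]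

lemma expC_C_mul (a : Option F) (c : F) (f : RatFunc F) (n : ℤ) :
    expC a (RatFunc.C c * f) n = c * expC a f n := by
  rw [expC_eq, expC_eq, map_mul, expHom_C, HahnSeries.C_mul_eq_smul, HahnSeries.coeff_smul, smul_eq_mul]

lemma expC_X_mul (a : Option F) (f : RatFunc F) (n : ℤ) :
    expC a (RatFunc.X * f) n = mulCoord a (expC a f) n := by
  rw [expC_eq, map_mul, expHom_X]
  cases a with
  | some b =>
    simp [mulCoord, expC_eq, add_mul, HahnSeries.coeff_single_mul]
  | none =>
    simp [mulCoord, expC_eq, HahnSeries.coeff_single_mul]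

lemma exists_forall_lt_expC_eq_zero (a : Option F) (f : RatFunc F) :
    ∃ l : ℤ, ∀ n < l, expC a f n = 0 :=
  ⟨(expHom a f).order, fun n hn => by
    rw [expC_eq]; exact HahnSeries.coeff_eq_zero_of_lt_order hn⟩

end Expansion

/-- a formal series in one variable has only finitely many negative powers -/
def BddBelowSupp {W : Type*} [Zero W] (h : ℤ → W) : Prop := ∃ l : ℤ, ∀ n < l, h n = 0

lemma int_induction_of_lt {P : ℤ → Prop} (h₀ : ∃ l : ℤ, ∀ n < l, P n)
    (h : ∀ n, (∀ m < n, P m) → P n) (n : ℤ) : P n := by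
  obtain ⟨l, hl⟩ := h₀
  have key : ∀ k : ℕ, ∀ m < l + k, P m := by
    intro k
    induction k with
    | zero => simpa using hl
    | succ k ih =>
      intro m hm
      refine h m fun m' hm' => ih m' ?_
      push_cast at hm
      lia
  exact key (n - l + 1).toNat n (by lia)

lemma finsum_eq_sum_Icc {W : Type*} [AddCommMonoid W] {h : ℤ → W} {l r : ℤ}
    (hl : ∀ n < l, h n = 0) (hr : ∀ n, r < n → h n = 0) :
    ∑ᶠ n, h n = ∑ n ∈ Finset.Icc l r, h n := by
  refine finsum_eq_sum_of_support_subset _ fun n hn => ?_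
  simp only [Finset.coe_Icc, Set.mem_Icc]
  by_contra hc
  rcases not_and_or.1 hc with h1 | h1
  · exact hn (hl n (not_le.1 h1))
  · exact hn (hr n (not_le.1 h1))

section Convolution

/-- the Cauchy product of formal series in one variable -/
def conv (f g : ℤ → ℂ) (n : ℤ) : ℂ := ∑ᶠ p : ℤ, f p * g (n - p)

lemma conv_eq_sum {f g : ℤ → ℂ} {l r n : ℤ} (hf : ∀ p < l, f p = 0)
    (hg : ∀ p < n - r, g p = 0) : conv f g n = ∑ p ∈ Finset.Icc l r, f p * g (n - p) :=
  finsum_eq_sum_Icc (fun p hp => by rw [hf p hp, zero_mul])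
    (fun p hp => by rw [hg _ (by lia), mul_zero])

lemma conv_comm (f g : ℤ → ℂ) (n : ℤ) : conv f g n = conv g f n := by
  unfold conv
  rw [← finsum_comp_equiv (Equiv.subLeft n)]
  refine finsum_congr fun p => ?_
  simp [mul_comm]

lemma conv_eq_zero {f g : ℤ → ℂ} {l r n : ℤ} (hf : ∀ p < l, f p = 0) (hg : ∀ p < r, g p = 0)
    (hn : n < l + r) : conv f g n = 0 := by
  unfold conv
  rw [← finsum_zero (α := ℤ)]
  refine finsum_congr fun p => ?_
  by_cases hp : p < l
  · rw [hf p hp, zero_mul]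
  · rw [hg _ (by lia), mul_zero]

lemma conv_add_right {f g h : ℤ → ℂ} (hf : BddBelowSupp f) (hg : BddBelowSupp g)
    (hh : BddBelowSupp h) (n : ℤ) :
    conv f (fun p => g p + h p) n = conv f g n + conv f h n := by
  obtain ⟨l, hl⟩ := hf
  obtain ⟨r, hr⟩ := hg
  obtain ⟨r', hr'⟩ := hh
  have h1 : ∀ p < n - (n - min r r'), g p = 0 := fun p hp => hr p (by lia)
  have h2 : ∀ p < n - (n - min r r'), h p = 0 := fun p hp => hr' p (by lia)
  rw [conv_eq_sum hl h1, conv_eq_sum hl h2, conv_eq_sum hl fun p hp => by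
    rw [h1 p hp, h2 p hp, add_zero], ← Finset.sum_add_distrib]
  exact Finset.sum_congr rfl fun p _ => by ring

lemma conv_smul_right (f g : ℤ → ℂ) (c : ℂ) (n : ℤ) :
    conv f (fun p => c * g p) n = c * conv f g n := by
  unfold conv
  rw [mul_finsum]
  exact finsum_congr fun p => by ring

lemma conv_shift_right (f g : ℤ → ℂ) (k n : ℤ) :
    conv f (fun p => g (p + k)) n = conv f g (n + k) := by
  unfold conv
  exact finsum_congr fun p => by ring_nf

lemma conv_ite (f : ℤ → ℂ) (c : ℂ) (n : ℤ) :
    conv f (fun p => if p = 0 then c else 0) n = c * f n := by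
  unfold conv
  rw [finsum_eq_single _ n]
  · simp [mul_comm]
  · intro p hp
    simp [show n - p ≠ 0 by lia]

lemma BddBelowSupp.shift {f : ℤ → ℂ} (hf : BddBelowSupp f) (k : ℤ) :
    BddBelowSupp fun p => f (p + k) := by
  obtain ⟨l, hl⟩ := hf
  exact ⟨l - k, fun p hp => hl _ (by lia)⟩

lemma BddBelowSupp.const_mul {f : ℤ → ℂ} (hf : BddBelowSupp f) (c : ℂ) :
    BddBelowSupp fun p => c * f p := by
  obtain ⟨l, hl⟩ := hf
  exact ⟨l, fun p hp => by simp [hl p hp]⟩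

lemma BddBelowSupp.add {f g : ℤ → ℂ} (hf : BddBelowSupp f) (hg : BddBelowSupp g) :
    BddBelowSupp fun p => f p + g p := by
  obtain ⟨l, hl⟩ := hf
  obtain ⟨l', hl'⟩ := hg
  exact ⟨min l l', fun p hp => by simp [hl p (by lia), hl' p (by lia)]⟩

lemma BddBelowSupp.mulCoord {f : ℤ → ℂ} (hf : BddBelowSupp f) (b : CP1) :
    BddBelowSupp (mulCoord b f) := by
  cases b with
  | some β => exact (hf.shift (-1)).add (hf.const_mul β)
  | none => exact hf.shift 1

lemma BddBelowSupp.mulCoord_family {f : ℤ → ℤ → ℂ} (hf : ∀ s, BddBelowSupp (f s)) (b : CP1)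
    (s : ℤ) : BddBelowSupp fun p => _root_.mulCoord b (fun s => f s p) s := by
  cases b with
  | some β => exact (hf _).add ((hf _).const_mul β)
  | none => exact hf _

lemma conv_mulCoord {f g : ℤ → ℂ} (hf : BddBelowSupp f) (hg : BddBelowSupp g) (b : CP1) (n : ℤ) :
    conv f (mulCoord b g) n = mulCoord b (conv f g) n := by
  cases b with
  | some β =>
    refine (conv_add_right hf (hg.shift (-1)) (hg.const_mul β) n).trans ?_
    rw [conv_shift_right, conv_smul_right]
    rfl
  | none => exact conv_shift_right f g 1 n

lemma conv_mulCoord_family {f : ℤ → ℂ} {g : ℤ → ℤ → ℂ} (hf : BddBelowSupp f)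
    (hg : ∀ s, BddBelowSupp (g s)) (b : CP1) (s n : ℤ) :
    conv f (fun p => mulCoord b (fun s => g s p) s) n = mulCoord b (fun s => conv f (g s) n) s := by
  cases b with
  | some β =>
    refine (conv_add_right hf (hg _) ((hg _).const_mul β) n).trans ?_
    rw [conv_smul_right]
    rfl
  | none => rfl

lemma mulCoord_add {W : Type*} [AddCommGroup W] [Module ℂ W] (b : CP1) (g h : ℤ → W) (n : ℤ) :
    mulCoord b (fun p => g p + h p) n = mulCoord b g n + mulCoord b h n := by
  cases b with
  | some β => simp only [mulCoord, smul_add]; abel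
  | none => rfl

lemma mulCoord_sub {W : Type*} [AddCommGroup W] [Module ℂ W] (b : CP1) (g h : ℤ → W) (n : ℤ) :
    mulCoord b (fun p => g p - h p) n = mulCoord b g n - mulCoord b h n := by
  cases b with
  | some β => simp only [mulCoord, smul_sub]; abel
  | none => rfl

lemma mulCoord_comm (a b : CP1) (h : ℤ → ℤ → ℂ) (m n : ℤ) :
    mulCoord a (fun m => mulCoord b (h m) n) m
      = mulCoord b (fun n => mulCoord a (fun m => h m n) m) n := by
  cases a <;> cases b <;> simp only [mulCoord, smul_eq_mul]
  ring

lemma mulCoord_translate (b : CP1) (h : ℤ → ℂ) (m s : ℤ) :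
    mulCoord b (fun m => h (m + s)) m = mulCoord b h (m + s) := by
  cases b <;> simp only [mulCoord] <;> ring_nf

lemma bddBelowSupp_ite (c : ℂ) : BddBelowSupp fun p : ℤ => if p = 0 then c else 0 :=
  ⟨0, fun _ hp => if_neg hp.ne⟩

end Convolution

/-- the double series `f a c` are the expansions, first in `κ_c` and then in `λ_a`, of the Cauchy
kernel `1/(κ−λ)` -/
structure IsCauchyKernel (f : CP1 → CP1 → ℤ → ℤ → ℂ) : Prop where
  neg : ∀ a c t p, p < 0 → f a c t p = 0
  bdd : ∀ a c p, BddBelowSupp fun t => f a c t p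
  eqn : ∀ a c t p, mulCoord c (f a c t) p - mulCoord a (fun t => f a c t p) t
    = if t = 0 ∧ p = 0 then 1 else 0

lemma expC_cMuOuter_eqn (c : CP1) (p : ℤ) :
    mulCoord (pt c) (expC (pt c) cMuOuter) p - RatFunc.X * expC (pt c) cMuOuter p
      = if p = 0 then 1 else 0 := by
  have hne : (RatFunc.X - RatFunc.C (RatFunc.X : Rf) : Rf2) ≠ 0 := by
    rw [sub_ne_zero, ← RatFunc.algebraMap_X, ← RatFunc.algebraMap_C]
    intro h
    exact Polynomial.X_ne_C _ (RatFunc.algebraMap_injective _ h)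
  rw [← expC_X_mul, ← expC_C_mul, ← expC_sub, ← sub_mul, cMuOuter, mul_inv_cancel₀ hne, expC_one]

lemma expC_cMuOuter_neg (c : CP1) (p : ℤ) (hp : p < 0) : expC (pt c) cMuOuter p = 0 := by
  revert hp
  refine int_induction_of_lt (P := fun p => p < 0 → expC (pt c) cMuOuter p = 0) ?_ ?_ p
  · obtain ⟨l, hl⟩ := exists_forall_lt_expC_eq_zero (pt c) cMuOuter
    exact ⟨l, fun n hn _ => hl n hn⟩
  · intro n ih hn
    have h1 := ih (n - 1) (by lia) (by lia)
    cases c with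
    | some γ =>
      have h := expC_cMuOuter_eqn (some γ) n
      rw [if_neg hn.ne] at h
      simp only [pt, Option.map_some, mulCoord] at h h1 ⊢
      rw [h1, zero_add, smul_eq_mul, ← sub_mul] at h
      refine (mul_eq_zero.1 h).resolve_left ?_
      rw [sub_eq_zero, RatFunc.algebraMap_eq_C, ← RatFunc.algebraMap_X, ← RatFunc.algebraMap_C]
      intro h
      exact Polynomial.X_ne_C _ (RatFunc.algebraMap_injective _ h).symm
    | none =>
      have h := expC_cMuOuter_eqn none (n - 1)
      rw [if_neg (by lia), h1, mul_zero, sub_zero] at h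
      simpa [pt, mulCoord] using h

lemma expC_mulCoord (a c : CP1) (h : ℤ → Rf) (t p : ℤ) :
    expC a (mulCoord (pt c) h p) t = mulCoord c (fun p => expC a (h p) t) p := by
  cases c with
  | some γ =>
    simp only [pt, Option.map_some, mulCoord]
    rw [expC_add, smul_eq_mul, RatFunc.algebraMap_eq_C, expC_C_mul, smul_eq_mul]
  | none => rfl

lemma isCauchyKernel_cMuOuter : IsCauchyKernel (dMuFirst cMuOuter) where
  neg a c t p hp := by rw [dMuFirst, expC_cMuOuter_neg c p hp, expC_zero]
  bdd a c p := exists_forall_lt_expC_eq_zero a _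
  eqn a c t p := by
    have h := congrArg (fun x => expC a x t) (expC_cMuOuter_eqn c p)
    simp only [expC_sub, expC_mulCoord, expC_X_mul] at h
    refine h.trans ?_
    by_cases hp : p = 0 <;> simp [hp, expC_one, expC_zero]

lemma dMuFirst_sMuOuter (a c : CP1) (t p : ℤ) :
    dMuFirst sMuOuter a c t p = mulCoord c (dMuFirst cMuOuter a c t) p := by
  have h : sMuOuter = RatFunc.X * cMuOuter := rfl
  rw [dMuFirst, h, expC_X_mul, expC_mulCoord]
  rfl

lemma eq_zero_of_mulCoord_eq {a b : CP1} {h : ℤ → ℤ → ℂ}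
    (H : ∀ t p, mulCoord b (h t) p = mulCoord a (fun t => h t p) t)
    (hp : ∃ l : ℤ, ∀ p < l, ∀ t, h t p = 0) (ht : ∀ p, BddBelowSupp fun t => h t p) (t p : ℤ) :
    h t p = 0 := by
  revert t
  refine int_induction_of_lt (P := fun p => ∀ t, h t p = 0) hp (fun p ih => ?_) p
  have h1 := ih (p - 1) (by lia)
  cases b with
  | none =>
    intro t
    have h2 := H t (p - 1)
    cases a <;> simpa [mulCoord, h1] using h2
  | some β =>
    cases a with
    | none =>
      refine int_induction_of_lt (ht p) fun t iht => ?_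
      have h2 := H (t - 1) p
      simpa [mulCoord, h1, iht (t - 1) (by lia)] using h2.symm
    | some α =>
      by_cases hab : β = α
      · intro t
        have h2 := H (t + 1) p
        simpa [mulCoord, h1, hab] using h2.symm
      · refine int_induction_of_lt (ht p) fun t iht => ?_
        have h2 := H t p
        simp only [mulCoord, h1, iht (t - 1) (by lia), zero_add, smul_eq_mul] at h2
        rw [← sub_eq_zero, ← sub_mul] at h2
        exact (mul_eq_zero.1 h2).resolve_left (sub_ne_zero.2 hab)

namespace IsCauchyKernel
variable {f : CP1 → CP1 → ℤ → ℤ → ℂ} (hf : IsCauchyKernel f)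
include hf

lemma bdd' (a c : CP1) (t : ℤ) : BddBelowSupp (f a c t) := ⟨0, fun p hp => hf.neg a c t p hp⟩

lemma eq_zero_of_ne {b c : CP1} (hbc : b ≠ c) (m s : ℤ) (hm : m < 0) : f b c m s = 0 := by
  revert m
  refine int_induction_of_lt (P := fun s => ∀ m < 0, f b c m s = 0)
    ⟨0, fun s hs m _ => hf.neg b c m s hs⟩ (fun s ih => ?_) s
  have h1 := ih (s - 1) (by lia)
  cases c with
  | none =>
    intro m hm
    have h2 := hf.eqn b none m (s - 1)
    cases b with
    | none => exact absurd rfl hbc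
    | some β =>
      rw [if_neg (by lia)] at h2
      simpa [mulCoord, h1 _ hm, h1 (m - 1) (by lia)] using h2
  | some γ =>
    have hb : ∃ l : ℤ, ∀ m < l, m < 0 → f b (some γ) m s = 0 := by
      obtain ⟨l, hl⟩ := hf.bdd b (some γ) s
      exact ⟨l, fun m hm _ => hl m hm⟩
    refine int_induction_of_lt hb fun m ihm hm => ?_
    have ihm' := ihm (m - 1) (by lia) (by lia)
    cases b with
    | none =>
      have h2 := hf.eqn none (some γ) (m - 1) s
      rw [if_neg (by lia)] at h2
      simpa [mulCoord, h1 (m - 1) (by lia), ihm'] using h2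
    | some β =>
      have h2 := hf.eqn (some β) (some γ) m s
      rw [if_neg (by lia)] at h2
      simp only [mulCoord, h1 m hm, ihm', zero_add, smul_eq_mul] at h2
      rw [← sub_mul] at h2
      refine (mul_eq_zero.1 h2).resolve_left (sub_ne_zero.2 fun h => hbc ?_)
      rw [h]

lemma delta_eqn (b c : CP1) (m s : ℤ) :
    mulCoord c (fun s => f b c m s + f c b s m) s
      = mulCoord b (fun m => f b c m s + f c b s m) m := by
  have h1 := hf.eqn b c m s
  have h2 := hf.eqn c b s m
  rw [mulCoord_add, mulCoord_add]
  simp only [and_comm (a := s = 0)] at h2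
  linear_combination h1 - h2

lemma exists_delta (b c : CP1) : ∃ ψ : ℤ → ℂ, (b ≠ c → ψ = 0) ∧
    ∀ m s, f b c m s + f c b s m = ψ (m + s) := by
  by_cases hbc : b = c
  · subst hbc
    refine ⟨fun k => f b b k 0 + f b b 0 k, fun h => absurd rfl h, ?_⟩
    have hstep : ∀ m s, f b b m (s + 1) + f b b (s + 1) m
        = f b b (m + 1) s + f b b s (m + 1) := by
      intro m s
      cases b with
      | none => simpa [mulCoord] using hf.delta_eqn none none m s
      | some β => simpa [mulCoord] using (hf.delta_eqn (some β) (some β) (m + 1) (s + 1)).symm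
    intro m s
    induction s using Int.induction_on generalizing m with
    | zero => simp
    | succ s ih =>
      rw [hstep, ih]
      ring_nf
    | pred s ih =>
      have h := hstep (m - 1) (-s - 1)
      rw [sub_add_cancel, sub_add_cancel] at h
      rw [← h, ih]
      ring_nf
  · refine ⟨0, fun _ => rfl, fun m s => ?_⟩
    refine eq_zero_of_mulCoord_eq (h := fun m s => f b c m s + f c b s m) (hf.delta_eqn b c) ?_ ?_ m s
    · exact ⟨0, fun s hs m => by
        rw [hf.neg b c m s hs, hf.eq_zero_of_ne (Ne.symm hbc) s m hs, add_zero]⟩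
    · exact fun s => (hf.bdd b c s).add (hf.bdd' c b s)

lemma exists_forall_le (a c : CP1) (P : ℤ) : ∃ l : ℤ, ∀ t < l, ∀ p ≤ P, f a c t p = 0 := by
  refine int_induction_of_lt (P := fun P => ∃ l : ℤ, ∀ t < l, ∀ p ≤ P, f a c t p = 0)
    ⟨0, fun P hP => ⟨0, fun t _ p hp => hf.neg a c t p (by lia)⟩⟩ (fun P ih => ?_) P
  obtain ⟨l, hl⟩ := ih (P - 1) (by lia)
  obtain ⟨r, hr⟩ := hf.bdd a c P
  refine ⟨min l r, fun t ht p hp => ?_⟩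
  rcases hp.lt_or_eq with h | rfl
  · exact hl t (by lia) p (by lia)
  · exact hr t (by lia)

end IsCauchyKernel

/-- The scalar part of the classical Yang–Baxter equation for a double series `d`. The product
`d_ab(λ,μ) d_bc(μ,ν) + d_ac(λ,ν) d_cb(ν,μ) − d_ab(λ,μ) d_ac(λ,ν)` and the failure of skew-symmetry
`d_bc(μ,ν) + d_cb(ν,μ) − ε` are supported at `b = c`, where their coefficients at `μ^m ν^s` depend
only on `m + s`: they are multiples of the delta function. -/
structure IsYangBaxterKernel (d : CP1 → CP1 → ℤ → ℤ → ℂ) (ε : ℂ) : Prop where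
  neg : ∀ a c t p, p < 0 → d a c t p = 0
  unif : ∀ a c P, ∃ l : ℤ, ∀ t < l, ∀ p ≤ P, d a c t p = 0
  triple : ∀ a b c, ∃ φ : ℤ → ℤ → ℂ, (b ≠ c → φ = 0) ∧ ∀ t m s,
    conv (d a b t) (fun p => d b c p s) m + conv (d a c t) (fun p => d c b p m) s
      - conv (fun u => d a b u m) (fun u => d a c u s) t = φ t (m + s)
  delta : ∀ b c, ∃ ψ : ℤ → ℂ, (b ≠ c → ψ = 0) ∧ ∀ m s,
    d b c m s + d c b s m = (if m = 0 ∧ s = 0 then ε else 0) + ψ (m + s)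

namespace IsCauchyKernel
variable {f : CP1 → CP1 → ℤ → ℤ → ℂ} (hf : IsCauchyKernel f)
include hf

lemma mulCoord_conv {F : ℤ → ℂ} (hF : BddBelowSupp F) (a c : CP1) (t n : ℤ) :
    mulCoord c (conv F (f a c t)) n
      = mulCoord a (fun t => conv F (f a c t) n) t + if t = 0 then F n else 0 := by
  have h : mulCoord c (f a c t) = fun p => mulCoord a (fun t => f a c t p) t
      + if p = 0 then (if t = 0 then 1 else 0) else 0 := by
    funext p
    rw [← sub_eq_iff_eq_add', hf.eqn]
    split_ifs <;> simp_all
  rw [← conv_mulCoord hF (hf.bdd' a c t), h, conv_add_right hF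
    (BddBelowSupp.mulCoord_family (hf.bdd' a c) a t) (bddBelowSupp_ite _), conv_ite,
    conv_mulCoord_family hF (hf.bdd' a c)]
  simp

lemma mulCoord_conv_left {F : ℤ → ℂ} (hF : BddBelowSupp F) (a c : CP1) (p n : ℤ) :
    mulCoord c (fun p => conv F (fun t => f a c t p) n) p
      = mulCoord a (conv F (fun t => f a c t p)) n + if p = 0 then F n else 0 := by
  have h : (fun t => mulCoord c (f a c t) p) = fun t => mulCoord a (fun t => f a c t p) t
      + if t = 0 then (if p = 0 then 1 else 0) else 0 := by
    funext t
    rw [← sub_eq_iff_eq_add', hf.eqn]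
    split_ifs <;> simp_all
  rw [← conv_mulCoord_family (g := fun p t => f a c t p) hF (hf.bdd a c), h, conv_add_right hF
    ((hf.bdd a c p).mulCoord a) (bddBelowSupp_ite _), conv_ite, conv_mulCoord hF (hf.bdd a c p)]
  simp

/-- the partial fraction identity
`1/((μ−λ)(ν−λ)) − 1/((μ−λ)(ν−μ)) + 1/((ν−λ)(ν−μ)) = 0`, all kernels being expanded first in `ν`, then
in `μ`, then in `λ` -/
lemma partial_fractions (a b c : CP1) (t m s : ℤ) :
    conv (fun u => f a b u m) (fun u => f a c u s) t - conv (f a b t) (fun p => f b c p s) m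
      + conv (f a c t) (f b c m) s = 0 := by
  have hbc := hf.bdd b c s
  have hac := hf.bdd a c s
  obtain ⟨l, hl⟩ := hf.exists_forall_le b c s
  refine eq_zero_of_mulCoord_eq (a := a) (b := b) (h := fun t m =>
    conv (fun u => f a b u m) (fun u => f a c u s) t - conv (f a b t) (fun p => f b c p s) m
      + conv (f a c t) (f b c m) s) ?_ ?_ ?_ t m
  · intro t m
    simp only [conv_comm (fun u => f a b u _) (fun u => f a c u s),
      conv_comm (f a b _) (fun p => f b c p s)]
    have e1 := hf.mulCoord_conv_left hac a b m t
    have e2 := hf.mulCoord_conv hbc a b t m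
    have e3 := hf.mulCoord_conv (hf.bdd' a c t) b c m s
    have e4 := hf.mulCoord_conv (hf.bdd' b c m) a c t s
    have e5 : conv (f b c m) (f a c t) = conv (f a c t) (f b c m) := funext (conv_comm _ _)
    rw [e5] at e4
    simp only [conv_comm (f b c m)] at e4
    rw [mulCoord_add, mulCoord_add, mulCoord_sub, mulCoord_sub]
    linear_combination e1 - e2 - e3 + e4
  · refine ⟨min 0 l, fun m hm t => ?_⟩
    have h1 : conv (fun u => f a b u m) (fun u => f a c u s) t = 0 := by
      simp [conv, hf.neg a b _ m (by lia)]
    have h2 : conv (f a b t) (fun p => f b c p s) m = 0 :=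
      conv_eq_zero (hf.neg a b t) (fun p hp => hl p hp s le_rfl) (by lia)
    have h3 : conv (f a c t) (f b c m) s = 0 := by
      rw [conv_eq_sum (l := 0) (r := s) (hf.neg a c t) fun p hp => hf.neg b c m p (by lia)]
      refine Finset.sum_eq_zero fun p hp => ?_
      rw [hl m (by lia) _ (by linarith [(Finset.mem_Icc.1 hp).1]), mul_zero]
    rw [h1, h2, h3]
    ring
  · intro m
    obtain ⟨l₁, hl₁⟩ := hf.bdd a b m
    obtain ⟨l₂, hl₂⟩ := hac
    obtain ⟨l₃, hl₃⟩ := hf.exists_forall_le a b (m - l)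
    obtain ⟨l₄, hl₄⟩ := hf.exists_forall_le a c s
    refine ⟨min (l₁ + l₂) (min l₃ l₄), fun t ht => ?_⟩
    have h1 : conv (fun u => f a b u m) (fun u => f a c u s) t = 0 :=
      conv_eq_zero hl₁ hl₂ (by lia)
    have h2 : conv (f a b t) (fun p => f b c p s) m = 0 := by
      refine conv_eq_zero (l := m - l + 1) (r := l) (fun p hp => hl₃ t (by lia) p (by lia))
        (fun p hp => hl p hp s le_rfl) (by lia)
    have h3 : conv (f a c t) (f b c m) s = 0 := by
      refine conv_eq_zero (l := s + 1) (r := 0) (fun p hp => hl₄ t (by lia) p (by lia))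
        (hf.neg b c m) (by lia)
    simp only [h1, h2, h3]
    ring

lemma isYangBaxterKernel : IsYangBaxterKernel f 0 where
  neg := hf.neg
  unif := hf.exists_forall_le
  triple a b c := by
    obtain ⟨ψ, hψ, h⟩ := hf.exists_delta b c
    refine ⟨fun t k => conv (f a c t) (fun p => ψ (p + k)) 0, fun hbc => ?_, fun t m s => ?_⟩
    · simp [hψ hbc, conv]
      rfl
    · have h1 := hf.partial_fractions a b c t m s
      have h2 := conv_add_right (hf.bdd' a c t) (hf.bdd' b c m) (hf.bdd c b m) s
      simp only [h] at h2
      have h3 := conv_shift_right (f a c t) (fun p => ψ (m + p)) s 0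
      simp only [zero_add] at h3
      have h4 : (fun p => ψ (m + (p + s))) = fun p => ψ (p + (m + s)) := by
        funext p; ring_nf
      rw [h4] at h3
      change _ = conv (f a c t) (fun p => ψ (p + (m + s))) 0
      rw [h3]
      linear_combination -h1 - h2
  delta b c := by
    simpa using hf.exists_delta b c

/-- multiplication by `κ` turns the Cauchy kernel into `κ/(κ−λ)` -/
lemma isYangBaxterKernel_mulCoord {g : CP1 → CP1 → ℤ → ℤ → ℂ}
    (hg : ∀ a c t p, g a c t p = mulCoord c (f a c t) p) : IsYangBaxterKernel g 1 where
  neg a c t p hp := by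
    have h0 := hf.neg a c t p hp
    rw [hg]
    cases c with
    | some γ => simp [mulCoord, h0, hf.neg a (some γ) t (p - 1) (by lia)]
    | none =>
      have h1 := hf.eqn a none t p
      rw [if_neg (by lia), sub_eq_zero] at h1
      rw [h1]
      cases a <;> simp [mulCoord, hf.neg _ none _ p hp]
  unif a c P := by
    obtain ⟨l, hl⟩ := hf.exists_forall_le a c (P + 1)
    refine ⟨l, fun t ht p hp => ?_⟩
    rw [hg]
    cases c with
    | some γ => simp [mulCoord, hl t ht p (by lia), hl t ht (p - 1) (by lia)]
    | none => exact hl t ht _ (by lia)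
  triple a b c := by
    obtain ⟨φ, hφ, h⟩ := hf.isYangBaxterKernel.triple a b c
    have hgf : ∀ a c t, g a c t = mulCoord c (f a c t) := fun a c t => funext (hg a c t)
    have key : ∀ b c t m s, conv (g a b t) (fun p => g b c p s) m
        = mulCoord b (fun m => mulCoord c (fun s => conv (f a b t) (fun p => f b c p s) m) s) m := by
      intro b c t m s
      have hB : BddBelowSupp fun p => g b c p s := by
        simp only [hgf]
        exact BddBelowSupp.mulCoord_family (f := fun s p => f b c p s) (hf.bdd b c) c s
      rw [conv_comm, hgf a b t, conv_mulCoord hB (hf.bdd' a b t)]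
      congr 1
      funext m
      rw [conv_comm]
      simp only [hgf]
      exact conv_mulCoord_family (g := fun s p => f b c p s) (hf.bdd' a b t) (hf.bdd b c) c s m
    have key' : ∀ t m s, conv (fun u => g a b u m) (fun u => g a c u s) t
        = mulCoord b (fun m => mulCoord c
            (fun s => conv (fun u => f a b u m) (fun u => f a c u s) t) s) m := by
      intro t m s
      have hB : BddBelowSupp fun u => g a c u s := by
        simp only [hgf]
        exact BddBelowSupp.mulCoord_family (f := fun s p => f a c p s) (hf.bdd a c) c s
      rw [conv_comm]
      simp only [hgf a b]
      refine (conv_mulCoord_family (g := fun m u => f a b u m) hB (hf.bdd a b) b m t).trans ?_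
      congr 1
      funext m
      rw [conv_comm]
      simp only [hgf]
      exact conv_mulCoord_family (g := fun s p => f a c p s) (hf.bdd a b m) (hf.bdd a c) c s t
    refine ⟨fun t => mulCoord b (mulCoord c (φ t)), fun hbc => ?_, fun t m s => ?_⟩
    · funext t k
      rw [hφ hbc]
      cases b <;> cases c <;> simp [mulCoord]
    · rw [key, key, key', mulCoord_comm c b, ← mulCoord_add, ← mulCoord_sub]
      simp only [← mulCoord_add, ← mulCoord_sub, h]
      have h1 : ∀ m, mulCoord c (fun s => φ t (m + s)) s = mulCoord c (φ t) (m + s) := by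
        intro m
        simp only [add_comm m]
        rw [mulCoord_translate]
      simp only [h1, mulCoord_translate]
  delta b c := by
    obtain ⟨ψ, hψ, h⟩ := hf.exists_delta b c
    refine ⟨mulCoord b ψ, fun hbc => ?_, fun m s => ?_⟩
    · funext k
      cases b <;> simp [mulCoord, hψ hbc]
    · have h1 := hf.eqn b c m s
      have h2 := mulCoord_add b (fun m => f b c m s) (f c b s) m
      simp only [h, mulCoord_translate] at h2
      rw [hg, hg]
      linear_combination h1 - h2

end IsCauchyKernel

section LieSeries
variable {V : Type*} [LieRing V] [LieAlgebra ℂ V]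

/-- `Tr₂(T₁₂(λ,κ) M₂(κ))` at `λ^t κ^m`, for a kernel `T` with operator coefficients -/
def kernelTr (T : ℤ → ℤ → V →ₗ[ℂ] V) (M : ℤ → V) (t m : ℤ) : V := ∑ᶠ p : ℤ, T t p (M (m - p))

/-- `[Tr₂(T₁₂(λ,κ) C₂(κ)), A(λ)]` at `λ^t κ^s` -/
def kernelLie (T : ℤ → ℤ → V →ₗ[ℂ] V) (A C : ℤ → V) (t s : ℤ) : V :=
  ∑ᶠ u : ℤ, ⁅kernelTr T C u s, A (t - u)⁆

variable {T T' T'' : ℤ → ℤ → V →ₗ[ℂ] V} {A B C : ℤ → V}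

lemma kernelTr_eq_sum (hT : ∀ t p, p < 0 → T t p = 0) {L n m : ℤ} (hC : ∀ k < L, C k = 0)
    (hn : m ≤ n) (t : ℤ) : kernelTr T C t m = ∑ k ∈ Finset.Icc L n, T t (m - k) (C k) := by
  unfold kernelTr
  rw [← finsum_comp_equiv (Equiv.subLeft m), finsum_eq_sum_Icc (l := L) (r := n)]
  · exact Finset.sum_congr rfl fun k _ => by simp
  · intro k hk
    simp [hC k hk]
  · intro k hk
    simp [hT t (m - k) (by lia)]

lemma kernelTr_eq_zero (hT : ∀ t p, p < 0 → T t p = 0) {L l s t : ℤ} (hC : ∀ k < L, C k = 0)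
    (hl : ∀ t < l, ∀ p ≤ s - L, T t p = 0) (ht : t < l) : kernelTr T C t s = 0 := by
  rw [kernelTr_eq_sum hT hC le_rfl]
  refine Finset.sum_eq_zero fun k hk => ?_
  rw [hl t ht _ (by linarith [(Finset.mem_Icc.1 hk).1]), LinearMap.zero_apply]

lemma kernelLie_eq_sum (hT : ∀ t p, p < 0 → T t p = 0) {L L' l n n' s t : ℤ}
    (hA : ∀ i < L, A i = 0) (hC : ∀ k < L', C k = 0)
    (hl : ∀ t < l, ∀ p ≤ s - L', T t p = 0) (hn : t - l ≤ n) (hn' : s ≤ n') :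
    kernelLie T A C t s
      = ∑ i ∈ Finset.Icc L n, ∑ k ∈ Finset.Icc L' n', ⁅T (t - i) (s - k) (C k), A i⁆ := by
  unfold kernelLie
  rw [← finsum_comp_equiv (Equiv.subLeft t), finsum_eq_sum_Icc (l := L) (r := n)]
  · refine Finset.sum_congr rfl fun i _ => ?_
    simp [kernelTr_eq_sum hT hC hn', sum_lie]
  · intro i hi
    simp [hA i hi]
  · intro i hi
    simp [kernelTr_eq_zero hT hC hl (show t - i < l by lia)]

lemma kernelLie_eq_zero (hT : ∀ t p, p < 0 → T t p = 0) {L L' l s t : ℤ}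
    (hA : ∀ i < L, A i = 0) (hC : ∀ k < L', C k = 0)
    (hl : ∀ t < l, ∀ p ≤ s - L', T t p = 0) (ht : t < L + l) : kernelLie T A C t s = 0 := by
  rw [kernelLie_eq_sum hT (n := t - l) hA hC hl le_rfl le_rfl, Finset.Icc_eq_empty (by lia),
    Finset.sum_empty]

/-- the part of the second variation coming from the variation of `Tr₂(r₁₂ Q₂)` -/
lemma eventually_kernelLie_nested (hT : ∀ t p, p < 0 → T t p = 0)
    (hT' : ∀ t p, p < 0 → T' t p = 0) (hTu : ∀ P, ∃ l : ℤ, ∀ t < l, ∀ p ≤ P, T t p = 0)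
    (hTu' : ∀ P, ∃ l : ℤ, ∀ t < l, ∀ p ≤ P, T' t p = 0) {L : ℤ} (hA : ∀ i < L, A i = 0)
    (hB : ∀ i < L, B i = 0) (hC : ∀ i < L, C i = 0) (t m s : ℤ) :
    ∀ᶠ n in Filter.atTop, kernelLie T A (fun m => kernelLie T' B C m s) t m
      = ∑ i ∈ Finset.Icc L n, ∑ j ∈ Finset.Icc L n, ∑ k ∈ Finset.Icc L n,
        ⁅∑ᶠ p : ℤ, T (t - i) (m - j - p) ⁅T' p (s - k) (C k), B j⁆, A i⁆ := by
  obtain ⟨l', hl'⟩ := hTu' (s - L)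
  obtain ⟨l, hl⟩ := hTu (m - (L + l'))
  filter_upwards [Filter.eventually_ge_atTop (t - l), Filter.eventually_ge_atTop (m - l'),
    Filter.eventually_ge_atTop s] with n hn hn' hs
  rw [kernelLie_eq_sum hT hA (fun k hk => kernelLie_eq_zero hT' hB hC hl' hk) hl hn le_rfl]
  refine Finset.sum_congr rfl fun i _ => ?_
  have h1 : ∀ q ∈ Finset.Icc (L + l') m, ⁅T (t - i) (m - q) (kernelLie T' B C q s), A i⁆
      = ∑ j ∈ Finset.Icc L n, ∑ k ∈ Finset.Icc L n,
        ⁅T (t - i) (m - q) ⁅T' (q - j) (s - k) (C k), B j⁆, A i⁆ := by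
    intro q hq
    rw [kernelLie_eq_sum hT' (n := n) (n' := n) hB hC hl'
      (by linarith [(Finset.mem_Icc.1 hq).2]) hs]
    simp only [map_sum, sum_lie]
  rw [Finset.sum_congr rfl h1, Finset.sum_comm]
  refine Finset.sum_congr rfl fun j hj => ?_
  rw [Finset.sum_comm]
  refine Finset.sum_congr rfl fun k hk => ?_
  rw [← sum_lie, ← finsum_comp_equiv (Equiv.subRight j),
    finsum_eq_sum_Icc (l := L + l') (r := m)]
  · congr 1
    refine Finset.sum_congr rfl fun q _ => ?_
    simp
  · intro q hq
    have hj' := (Finset.mem_Icc.1 hj).1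
    have hk' := (Finset.mem_Icc.1 hk).1
    simp [hl' (q - j) (by lia) (s - k) (by lia)]
  · intro q hq
    simp [hT (t - i) (m - q) (by lia)]

/-- the part of the second variation coming from the variation of `Q₁` -/
lemma eventually_kernelLie_outer (hT : ∀ t p, p < 0 → T t p = 0)
    (hT' : ∀ t p, p < 0 → T' t p = 0) (hTu : ∀ P, ∃ l : ℤ, ∀ t < l, ∀ p ≤ P, T t p = 0)
    (hTu' : ∀ P, ∃ l : ℤ, ∀ t < l, ∀ p ≤ P, T' t p = 0) {L : ℤ} (hA : ∀ i < L, A i = 0)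
    (hB : ∀ i < L, B i = 0) (hC : ∀ i < L, C i = 0) (t m s : ℤ) :
    ∀ᶠ n in Filter.atTop, kernelLie T (fun t => kernelLie T' A C t s) B t m
      = ∑ i ∈ Finset.Icc L n, ∑ j ∈ Finset.Icc L n, ∑ k ∈ Finset.Icc L n,
        ∑ᶠ u : ℤ, ⁅T u (m - j) (B j), ⁅T' (t - i - u) (s - k) (C k), A i⁆⁆ := by
  obtain ⟨l', hl'⟩ := hTu' (s - L)
  obtain ⟨l, hl⟩ := hTu (m - L)
  filter_upwards [Filter.eventually_ge_atTop (t - l - l'), Filter.eventually_ge_atTop m,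
    Filter.eventually_ge_atTop s] with n hn hm hs
  rw [kernelLie_eq_sum hT (fun k hk => kernelLie_eq_zero hT' hA hC hl' hk) hB hl le_rfl hm]
  have h1 : ∀ q ∈ Finset.Icc (L + l') (t - l), ∑ j ∈ Finset.Icc L n,
      ⁅T (t - q) (m - j) (B j), kernelLie T' A C q s⁆
      = ∑ i ∈ Finset.Icc L n, ∑ j ∈ Finset.Icc L n, ∑ k ∈ Finset.Icc L n,
        ⁅T (t - q) (m - j) (B j), ⁅T' (q - i) (s - k) (C k), A i⁆⁆ := by
    intro q hq
    rw [kernelLie_eq_sum hT' (n := n) (n' := n) hA hC hl'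
      (by linarith [(Finset.mem_Icc.1 hq).2]) hs]
    simp only [lie_sum]
    rw [Finset.sum_comm]
  rw [Finset.sum_congr rfl h1, Finset.sum_comm]
  refine Finset.sum_congr rfl fun i hi => ?_
  rw [Finset.sum_comm]
  refine Finset.sum_congr rfl fun j _ => ?_
  rw [Finset.sum_comm]
  refine Finset.sum_congr rfl fun k hk => ?_
  rw [← finsum_comp_equiv (Equiv.subLeft t), finsum_eq_sum_Icc (l := L + l') (r := t - l)]
  · refine Finset.sum_congr rfl fun q _ => ?_
    simp only [Equiv.subLeft_apply]
    rw [show t - i - (t - q) = q - i by ring]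
  · intro q hq
    have hi' := (Finset.mem_Icc.1 hi).1
    have hk' := (Finset.mem_Icc.1 hk).1
    simp only [Equiv.subLeft_apply]
    rw [show t - i - (t - q) = q - i by ring, hl' (q - i) (by lia) (s - k) (by lia)]
    simp
  · intro q hq
    have hj : T (t - q) (m - j) (B j) = 0 := by
      by_cases hj : j < L
      · rw [hB j hj, map_zero]
      · rw [hl (t - q) (by lia) _ (by lia), LinearMap.zero_apply]
    simp only [Equiv.subLeft_apply]
    rw [hj, zero_lie]

end LieSeries

section YangBaxter
variable {V : Type*} [LieRing V] [LieAlgebra ℂ V]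

/-- the r-matrix with scalar double series `d` and constant part `−R`, as an operator kernel -/
def rKernel (d : ℤ → ℤ → ℂ) (R : V →ₗ[ℂ] V) (t p : ℤ) : V →ₗ[ℂ] V :=
  d t p • LinearMap.id - if t = 0 ∧ p = 0 then R else 0

/-- `R` satisfies the Rota–Baxter identity of weight `−ε`, the classical Yang–Baxter equation for
the constant part of the r-matrix -/
def IsRotaBaxter (R : V →ₗ[ℂ] V) (ε : ℂ) : Prop :=
  ∀ Y Z : V, ⁅R Y, R Z⁆ - R ⁅Y, R Z⁆ - R ⁅R Y, Z⁆ + ε • R ⁅Y, Z⁆ = 0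

lemma rKernel_apply (d : ℤ → ℤ → ℂ) (R : V →ₗ[ℂ] V) (t p : ℤ) (X : V) :
    rKernel d R t p X = d t p • X - if t = 0 ∧ p = 0 then R X else 0 := by
  unfold rKernel
  split_ifs <;> simp

lemma rKernel_neg {d : ℤ → ℤ → ℂ} (hd : ∀ t p, p < 0 → d t p = 0) (R : V →ₗ[ℂ] V) (t p : ℤ)
    (hp : p < 0) : rKernel d R t p = 0 := by
  simp [rKernel, hd t p hp, hp.ne]

lemma rKernel_unif {d : ℤ → ℤ → ℂ} (hd : ∀ P, ∃ l : ℤ, ∀ t < l, ∀ p ≤ P, d t p = 0)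
    (R : V →ₗ[ℂ] V) (P : ℤ) : ∃ l : ℤ, ∀ t < l, ∀ p ≤ P, rKernel d R t p = 0 := by
  obtain ⟨l, hl⟩ := hd P
  refine ⟨min l 0, fun t ht p hp => ?_⟩
  simp [rKernel, hl t (by lia) p hp, show t ≠ 0 by lia]

lemma finsum_smul_sub_ite {W : Type*} [AddCommGroup W] [Module ℂ W] {f : ℤ → ℂ} {l r : ℤ}
    (hl : ∀ p < l, f p = 0) (hr : ∀ p, r < p → f p = 0) (v w w' : W) (q q' : ℤ) :
    ∑ᶠ p, (f p • v - (if p = q then w else 0) - if p = q' then w' else 0)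
      = (∑ᶠ p, f p) • v - w - w' := by
  set l' := min l (min q q')
  set r' := max r (max q q')
  rw [finsum_eq_sum_Icc (l := l') (r := r'), finsum_eq_sum_Icc (l := l') (r := r'),
    Finset.sum_sub_distrib, Finset.sum_sub_distrib, Finset.sum_smul, Finset.sum_ite_eq',
    Finset.sum_ite_eq', if_pos (Finset.mem_Icc.2 (by lia)), if_pos (Finset.mem_Icc.2 (by lia))]
  · exact fun p hp => hl p (by lia)
  · exact fun p hp => hr p (by lia)
  · intro p hp
    simp [hl p (by lia), show p ≠ q by lia, show p ≠ q' by lia]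
  · intro p hp
    simp [hr p (by lia), show p ≠ q by lia, show p ≠ q' by lia]

lemma finsum_rKernel_nested {d d' : ℤ → ℤ → ℂ} (hd : ∀ t p, p < 0 → d t p = 0)
    (hd' : ∀ s, BddBelowSupp fun p => d' p s) (R : V →ₗ[ℂ] V) (t m s : ℤ) (Y Z : V) :
    ∑ᶠ p : ℤ, rKernel d R t (m - p) ⁅rKernel d' R p s Z, Y⁆
      = conv (d t) (fun p => d' p s) m • ⁅Z, Y⁆
        - (if s = 0 then d t m • ⁅R Z, Y⁆ - (if t = 0 ∧ m = 0 then R ⁅R Z, Y⁆ else 0) else 0)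
        - (if t = 0 then d' m s • R ⁅Z, Y⁆ else 0) := by
  obtain ⟨l, hl⟩ := hd' s
  rw [conv_comm, conv, ← finsum_smul_sub_ite (l := l) (r := m) (fun p hp => by simp [hl p hp])
    (fun p hp => by simp [hd t (m - p) (by lia)]) _ _ _ 0 m]
  refine finsum_congr fun p => ?_
  have h : m - p = 0 ↔ p = m := by rw [sub_eq_zero, eq_comm]
  simp only [rKernel_apply, h]
  rcases eq_or_ne p m with rfl | hm
  · by_cases hp : p = 0 <;> by_cases hs : s = 0 <;> by_cases ht : t = 0 <;>
      simp [hp, hs, ht, smul_smul] <;> module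
  · rcases eq_or_ne p 0 with rfl | hp <;> by_cases hs : s = 0 <;> by_cases ht : t = 0 <;>
      simp [hm.symm, smul_smul, *] <;> module

lemma finsum_rKernel_outer {d d' : ℤ → ℤ → ℂ} (hd : ∀ s, BddBelowSupp fun p => d p s)
    (hd' : ∀ s, BddBelowSupp fun p => d' p s) (R : V →ₗ[ℂ] V) (t m s : ℤ) (X Y Z : V) :
    ∑ᶠ u : ℤ, ⁅rKernel d R u m Y, ⁅rKernel d' R (t - u) s Z, X⁆⁆
      = conv (fun u => d u m) (fun u => d' u s) t • ⁅Y, ⁅Z, X⁆⁆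
        - (if m = 0 then d' t s • ⁅R Y, ⁅Z, X⁆⁆
            - (if t = 0 ∧ s = 0 then ⁅R Y, ⁅R Z, X⁆⁆ else 0) else 0)
        - (if s = 0 then d t m • ⁅Y, ⁅R Z, X⁆⁆ else 0) := by
  obtain ⟨l, hl⟩ := hd m
  obtain ⟨l', hl'⟩ := hd' s
  rw [conv, ← finsum_smul_sub_ite (l := l) (r := t - l') (fun u hu => by simp [hl u hu])
    (fun u hu => by simp [hl' (t - u) (by lia)]) _ _ _ 0 t]
  refine finsum_congr fun u => ?_
  have h : t - u = 0 ↔ u = t := by rw [sub_eq_zero, eq_comm]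
  simp only [rKernel_apply, h]
  rcases eq_or_ne u t with rfl | ht
  · by_cases hu : u = 0 <;> by_cases hs : s = 0 <;> by_cases hm : m = 0 <;>
      simp [hu, hs, hm, smul_smul] <;> module
  · rcases eq_or_ne u 0 with rfl | hu <;> by_cases hs : s = 0 <;> by_cases hm : m = 0 <;>
      simp [ht.symm, smul_smul, *] <;> module

/-- the triple kernel of the second variation, with the coefficients `X`, `Y`, `Z` of `Q^a`, `Q^b`,
`Q^c` inserted -/
def secondVarKernel (d : CP1 → CP1 → ℤ → ℤ → ℂ) (R : V →ₗ[ℂ] V) (a b c : CP1) (t m s : ℤ)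
    (X Y Z : V) : V :=
  ⁅∑ᶠ p : ℤ, rKernel (d a b) R t (m - p) ⁅rKernel (d b c) R p s Z, Y⁆, X⁆
    + ∑ᶠ u : ℤ, ⁅rKernel (d a b) R u m Y, ⁅rKernel (d a c) R (t - u) s Z, X⁆⁆

variable {d : CP1 → CP1 → ℤ → ℤ → ℂ} {ε : ℂ} {R : V →ₗ[ℂ] V}

lemma IsYangBaxterKernel.bdd (hd : IsYangBaxterKernel d ε) (a c : CP1) (s : ℤ) :
    BddBelowSupp fun t => d a c t s := by
  obtain ⟨l, hl⟩ := hd.unif a c s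
  exact ⟨l, fun t ht => hl t ht s le_rfl⟩

/-- the classical Yang–Baxter equation in the form of symmetry of the triple kernel, up to an
antisymmetric multiple of the delta function when `b = c` -/
lemma secondVarKernel_swap (hd : IsYangBaxterKernel d ε) (hR : IsRotaBaxter R ε) (a b c : CP1) :
    ∃ H : ℤ → ℤ → V → V → V → V, (b ≠ c → ∀ t k X Y Z, H t k X Y Z = 0) ∧
      (∀ t k X Y Z, H t k X Z Y = -H t k X Y Z) ∧
      ∀ t m s X Y Z, secondVarKernel d R a b c t m s X Y Z
        = secondVarKernel d R a c b t s m X Z Y + H t (m + s) X Y Z := by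
  obtain ⟨φ, hφ, h⟩ := hd.triple a b c
  obtain ⟨ψ, hψ, h'⟩ := hd.delta b c
  refine ⟨fun t k X Y Z => (if t = 0 then ψ k else 0) • ⁅R ⁅Y, Z⁆, X⁆ - φ t k • ⁅⁅Y, Z⁆, X⁆,
    fun hbc t k X Y Z => ?_, fun t k X Y Z => ?_, fun t m s X Y Z => ?_⟩
  · simp [hφ hbc, hψ hbc]
  · beta_reduce
    rw [← lie_skew Y Z, map_neg, neg_lie, neg_lie]
    module
  · have e1 : ⁅Y, ⁅Z, X⁆⁆ - ⁅Z, ⁅Y, X⁆⁆ = ⁅⁅Y, Z⁆, X⁆ := (lie_lie Y Z X).symm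
    have e2 : ⁅⁅R Z, Y⁆, X⁆ = ⁅R Z, ⁅Y, X⁆⁆ - ⁅Y, ⁅R Z, X⁆⁆ := lie_lie _ _ _
    have e3 : ⁅⁅R Y, Z⁆, X⁆ = ⁅R Y, ⁅Z, X⁆⁆ - ⁅Z, ⁅R Y, X⁆⁆ := lie_lie _ _ _
    have e4 : ⁅⁅Z, Y⁆, X⁆ = -⁅⁅Y, Z⁆, X⁆ := by rw [← lie_skew Y Z, neg_lie, neg_neg]
    have e5 : ⁅R ⁅Z, Y⁆, X⁆ = -⁅R ⁅Y, Z⁆, X⁆ := by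
      rw [← lie_skew Y Z, map_neg, neg_lie, neg_neg]
    have e6 : ⁅R ⁅R Y, Z⁆, X⁆ - ⁅R ⁅R Z, Y⁆, X⁆
        = ⁅R Y, ⁅R Z, X⁆⁆ - ⁅R Z, ⁅R Y, X⁆⁆ + ε • ⁅R ⁅Y, Z⁆, X⁆ := by
      have h1 := congrArg (fun W => ⁅W, X⁆) (hR Y Z)
      have h2 : R ⁅R Z, Y⁆ = -R ⁅Y, R Z⁆ := by rw [← lie_skew Y (R Z), map_neg, neg_neg]
      simp only [add_lie, sub_lie, smul_lie, zero_lie, lie_lie (R Y) (R Z) X] at h1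
      rw [h2, neg_lie]
      linear_combination (norm := module) (-1 : ℂ) • h1
    have hφ' := h t m s
    have hψ' := h' m s
    rw [secondVarKernel, secondVarKernel, finsum_rKernel_nested (hd.neg a b) (hd.bdd b c),
      finsum_rKernel_nested (hd.neg a c) (hd.bdd c b),
      finsum_rKernel_outer (hd.bdd a b) (hd.bdd a c),
      finsum_rKernel_outer (hd.bdd a c) (hd.bdd a b),
      conv_comm (fun u => d a c u s)]
    have hite : ∀ (P : Prop) [Decidable P] (W : V),
        (if P then W else 0) = (if P then (1 : ℂ) else 0) • W := fun P _ W => by simp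
    have hite' : ∀ (P : Prop) [Decidable P] (x : ℂ),
        (if P then x else 0) = (if P then (1 : ℂ) else 0) * x := fun P _ x => by simp
    simp only [ite_and, hite' _ (ψ _), hite' (s = 0) ε, hite' (m = 0) (_ * _)] at hψ' ⊢
    simp only [hite _ (d _ _ _ _ • _), hite _ ⁅_, _⁆, hite _ (R _), hite _ (_ - _), hite _ (_ • _)]
    generalize (if t = 0 then (1 : ℂ) else 0) = τ at *
    generalize (if m = 0 then (1 : ℂ) else 0) = μ at *
    generalize (if s = 0 then (1 : ℂ) else 0) = σ at *
    simp only [sub_lie, smul_lie]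
    linear_combination (norm := module) (conv (d a b t) (fun p => d b c p s) m) • e4
      + (conv (fun u => d a b u m) (fun u => d a c u s) t) • e1 - (σ * d a b t m) • e2
      + (μ * d a c t s) • e3 - (τ * d b c m s) • e5 - (τ * μ * σ) • e6
      - hφ' • ⁅⁅Y, Z⁆, X⁆ + (τ * hψ') • ⁅R ⁅Y, Z⁆, X⁆

/-- the second variation, for the r-matrix with operator kernel `rKernel` -/
lemma secondVariation_comm (hd : IsYangBaxterKernel d ε) (hR : IsRotaBaxter R ε)
    {Q : CP1 → ℤ → V} (hQ : ∀ a, BddBelowSupp (Q a)) (a b c : CP1) (t m s : ℤ) :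
    kernelLie (rKernel (d a b) R) (Q a)
        (fun m => kernelLie (rKernel (d b c) R) (Q b) (Q c) m s) t m
      + kernelLie (rKernel (d a b) R)
        (fun t => kernelLie (rKernel (d a c) R) (Q a) (Q c) t s) (Q b) t m
    = kernelLie (rKernel (d a c) R) (Q a)
        (fun s => kernelLie (rKernel (d c b) R) (Q c) (Q b) s m) t s
      + kernelLie (rKernel (d a c) R)
        (fun t => kernelLie (rKernel (d a b) R) (Q a) (Q b) t m) (Q c) t s := by
  obtain ⟨L, hLa, hLb, hLc⟩ : ∃ L : ℤ, (∀ n < L, Q a n = 0) ∧ (∀ n < L, Q b n = 0) ∧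
      ∀ n < L, Q c n = 0 := by
    obtain ⟨x, hx⟩ := hQ a
    obtain ⟨y, hy⟩ := hQ b
    obtain ⟨z, hz⟩ := hQ c
    exact ⟨min x (min y z), fun n hn => hx n (by lia), fun n hn => hy n (by lia),
      fun n hn => hz n (by lia)⟩
  have hneg := fun a c => rKernel_neg (hd.neg a c) R
  have hunif := fun a c => rKernel_unif (hd.unif a c) R
  obtain ⟨n, ⟨h1, h2⟩, h3, h4⟩ :=
    (((eventually_kernelLie_nested (hneg a b) (hneg b c) (hunif a b) (hunif b c) hLa hLb hLc
      t m s).and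
    (eventually_kernelLie_outer (hneg a b) (hneg a c) (hunif a b) (hunif a c) hLa hLb hLc
      t m s)).and
    ((eventually_kernelLie_nested (hneg a c) (hneg c b) (hunif a c) (hunif c b) hLa hLc hLb
      t s m).and
    (eventually_kernelLie_outer (hneg a c) (hneg a b) (hunif a c) (hunif a b) hLa hLc hLb
      t s m))).exists
  obtain ⟨H, hH, hskew, hswap⟩ := secondVarKernel_swap hd hR a b c
  have e1 : ∀ i j k, secondVarKernel d R a b c (t - i) (m - j) (s - k) (Q a i) (Q b j) (Q c k)
      = secondVarKernel d R a c b (t - i) (s - k) (m - j) (Q a i) (Q c k) (Q b j)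
        + H (t - i) (m - j + (s - k)) (Q a i) (Q b j) (Q c k) := fun i j k => hswap _ _ _ _ _ _
  have e2 : ∀ i, ∑ j ∈ Finset.Icc L n, ∑ k ∈ Finset.Icc L n,
      H (t - i) (m - j + (s - k)) (Q a i) (Q b j) (Q c k) = 0 := by
    intro i
    by_cases hbc : b = c
    · subst hbc
      have := IsAddTorsionFree.of_isTorsionFree ℂ V
      rw [← self_eq_neg]
      nth_rw 1 [Finset.sum_comm]
      simp only [← Finset.sum_neg_distrib, ← hskew]
      refine Finset.sum_congr rfl fun j _ => Finset.sum_congr rfl fun k _ => ?_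
      rw [show m - k + (s - j) = m - j + (s - k) by ring]
    · simp [hH hbc]
  rw [h1, h2, h3, h4]
  simp only [← Finset.sum_add_distrib]
  refine Finset.sum_congr rfl fun i _ => ?_
  rw [Finset.sum_comm (γ := ℤ) (s := Finset.Icc L n) (t := Finset.Icc L n)
    (f := fun k j => ⁅∑ᶠ p : ℤ, rKernel (d a c) R (t - i) (s - k - p)
        ⁅rKernel (d c b) R p (m - j) (Q b j), Q c k⁆, Q a i⁆
      + ∑ᶠ u : ℤ, ⁅rKernel (d a c) R u (s - k) (Q c k),
        ⁅rKernel (d a b) R (t - i - u) (m - j) (Q b j), Q a i⁆⁆)]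
  refine Eq.trans ?_ (add_zero _)
  rw [← e2 i, ← Finset.sum_add_distrib]
  refine Finset.sum_congr rfl fun j _ => ?_
  rw [← Finset.sum_add_distrib]
  exact Finset.sum_congr rfl fun k _ => e1 i j k

end YangBaxter

attribute [local instance] LieRing.ofAssociativeRing

section ConstantPart
variable {N : ℕ}

/-- the constant part `P⁻ + ½P⁰` of the trigonometric r-matrix -/
def lowHalfDiag (N : ℕ) : glC N →ₗ[ℂ] glC N where
  toFun M := lowP M + (2 : ℂ)⁻¹ • diagP M
  map_add' X Y := by
    ext i j
    simp only [lowP, diagP, Matrix.add_apply, Matrix.smul_apply, Matrix.of_apply, smul_eq_mul]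
    split_ifs <;> ring
  map_smul' z X := by
    ext i j
    simp only [lowP, diagP, Matrix.add_apply, Matrix.smul_apply, Matrix.of_apply, smul_eq_mul,
      RingHom.id_apply]
    split_ifs <;> ring

lemma lowHalfDiag_apply (M : glC N) (i j : Fin N) :
    lowHalfDiag N M i j = (if j < i then 1 else if i = j then (2 : ℂ)⁻¹ else 0) * M i j := by
  simp only [lowHalfDiag, LinearMap.coe_mk, AddHom.coe_mk, lowP, diagP, Matrix.add_apply,
    Matrix.smul_apply, Matrix.of_apply, smul_eq_mul]
  rcases lt_trichotomy i j with h | rfl | h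
  · simp [h.not_gt, h.ne]
  · simp
  · simp [h, h.ne']

lemma isRotaBaxter_lowHalfDiag : IsRotaBaxter (lowHalfDiag N) 1 := by
  intro Y Z
  ext i j
  simp only [Ring.lie_def, Matrix.add_apply, Matrix.sub_apply,
    lowHalfDiag_apply, Matrix.mul_apply, one_smul, Matrix.zero_apply, mul_sub, Finset.mul_sum]
  simp only [← Finset.sum_sub_distrib, ← Finset.sum_add_distrib]
  refine Finset.sum_eq_zero fun k _ => ?_
  split_ifs <;> first
    | ring1
    | (exfalso; order)
    | (subst_vars; ring1)

lemma isRotaBaxter_zero {V : Type*} [LieRing V] [LieAlgebra ℂ V] :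
    IsRotaBaxter (0 : V →ₗ[ℂ] V) 0 := by
  intro Y Z
  simp

end ConstantPart

section Assembly
variable {N : ℕ} {d : CP1 → CP1 → ℤ → ℤ → ℂ} {ε : ℂ}

/-- the constant part of the r-matrix selected by `cpart` -/
def constPart (N : ℕ) (cpart : Bool) : glC N →ₗ[ℂ] glC N := if cpart then lowHalfDiag N else 0

lemma trIotaM_eq_kernelTr (hd : IsYangBaxterKernel d ε) (cpart : Bool) (a c : CP1)
    {M : ℤ → glC N} (hM : BddBelowSupp M) (t m : ℤ) :
    TrIotaM d cpart a c M t m = kernelTr (rKernel (d a c) (constPart N cpart)) M t m := by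
  obtain ⟨l, hl⟩ := hM
  have h0 : ∀ p < min 0 0, d a c t p = 0 := fun p hp => hd.neg a c t p (by lia)
  unfold TrIotaM kernelTr
  simp only [rKernel_apply]
  set r := max 0 (m - l)
  have hr : ∀ p, r < p → M (m - p) = 0 := fun p hp => hl _ (by lia)
  rw [finsum_eq_sum_Icc (l := 0) (r := r) (fun p hp => by rw [hd.neg a c t p hp, zero_smul])
    (fun p hp => by rw [hr p hp, smul_zero]),
    finsum_eq_sum_Icc (l := 0) (r := r) (fun p hp => by simp [hd.neg a c t p hp, hp.ne])
    (fun p hp => by simp [hr p hp]), Finset.sum_sub_distrib]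
  congr 1
  have h : ∀ p, (if t = 0 ∧ p = 0 then constPart N cpart (M (m - p)) else 0)
      = if p = 0 then (if t = 0 then constPart N cpart (M m) else 0) else 0 := by
    intro p
    by_cases hp : p = 0 <;> simp [hp]
  simp only [h]
  rw [Finset.sum_ite_eq', if_pos (Finset.mem_Icc.2 (by lia))]
  cases cpart <;> simp [constPart, lowHalfDiag]

lemma firstVar_eq_kernelLie (hd : IsYangBaxterKernel d ε) (cpart : Bool) {Q : AdeleData N}
    (hQ : LaurentBdd Q) (a c : CP1) (t s : ℤ) :
    firstVar d cpart Q a c t s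
      = kernelLie (rKernel (d a c) (constPart N cpart)) (Q a) (Q c) t s := by
  simp only [firstVar, kernelLie, trIotaM_eq_kernelTr hd cpart a c (hQ c), Ring.lie_def]

lemma bddBelowSupp_firstVar (hd : IsYangBaxterKernel d ε) (cpart : Bool) {Q : AdeleData N}
    (hQ : LaurentBdd Q) (a c : CP1) (s : ℤ) :
    BddBelowSupp fun t => firstVar d cpart Q a c t s := by
  obtain ⟨L, hL⟩ := hQ a
  obtain ⟨L', hL'⟩ := hQ c
  obtain ⟨l, hl⟩ := rKernel_unif (hd.unif a c) (constPart N cpart) (s - L')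
  refine ⟨L + l, fun t ht => ?_⟩
  beta_reduce
  rw [firstVar_eq_kernelLie hd cpart hQ]
  exact kernelLie_eq_zero (rKernel_neg (hd.neg a c) _) hL hL' hl ht

lemma secondVar_eq_kernelLie (hd : IsYangBaxterKernel d ε) (cpart : Bool) {Q : AdeleData N}
    (hQ : LaurentBdd Q) (a b c : CP1) (t m s : ℤ) :
    secondVar d cpart Q a b c t m s
      = kernelLie (rKernel (d a b) (constPart N cpart)) (Q a)
          (fun m => kernelLie (rKernel (d b c) (constPart N cpart)) (Q b) (Q c) m s) t m
        + kernelLie (rKernel (d a b) (constPart N cpart))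
          (fun t => kernelLie (rKernel (d a c) (constPart N cpart)) (Q a) (Q c) t s) (Q b) t m := by
  simp only [secondVar, trIotaM_eq_kernelTr hd cpart a b (hQ b),
    trIotaM_eq_kernelTr hd cpart a b (bddBelowSupp_firstVar hd cpart hQ b c s)]
  simp only [firstVar_eq_kernelLie hd cpart hQ, kernelLie, Ring.lie_def]

lemma secondVar_comm (hd : IsYangBaxterKernel d ε) (cpart : Bool)
    (hR : IsRotaBaxter (constPart N cpart) ε) {Q : AdeleData N} (hQ : LaurentBdd Q)
    (a b c : CP1) (t m s : ℤ) :
    secondVar d cpart Q a b c t m s = secondVar d cpart Q a c b t s m := by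
  rw [secondVar_eq_kernelLie hd cpart hQ, secondVar_eq_kernelLie hd cpart hQ]
  exact secondVariation_comm hd hR hQ a b c t m s

end Assembly

/-- the flows commute, `X_ν X_μ Q = X_μ X_ν Q`, componentwise as
triple formal series, for both the rational and the trigonometric r-matrix.
Exchanging `μ ↔ ν` exchanges `(b, m) ↔ (c, s)`. -/
theorem generating_flows_commute (N : ℕ) (Q : AdeleData N) (hQ : IsAdele Q) :
    (∀ (a b c : CP1) (t m s : ℤ),
      secondVar (dMuFirst cMuOuter) false Q a b c t m s
        = secondVar (dMuFirst cMuOuter) false Q a c b t s m) ∧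
    (∀ (a b c : CP1) (t m s : ℤ),
      secondVar (dMuFirst sMuOuter) true Q a b c t m s
        = secondVar (dMuFirst sMuOuter) true Q a c b t s m) := by
  refine ⟨secondVar_comm isCauchyKernel_cMuOuter.isYangBaxterKernel false ?_ hQ.1,
    secondVar_comm (isCauchyKernel_cMuOuter.isYangBaxterKernel_mulCoord dMuFirst_sMuOuter) true ?_
      hQ.1⟩
  · simpa [constPart] using isRotaBaxter_zero
  · simpa [constPart] using isRotaBaxter_lowHalfDiag

end
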